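/- The Riemann hypothesis holds if and only if for every ε > 0, Riesz(x) = O(x^{1/4 + ε}) as x → ∞ along the positive reals. -/

import Mathlib

open Complex Filter Asymptotics

/-- The function `F` with `Riesz(x) = x * F(x)`. -/
noncomputable def rieszKernel (x : ℝ) : ℂ :=
  ∑' n : ℕ, (ArithmeticFunction.moebius n : ℂ) / (n : ℂ) ^ 2 *
    (Real.exp (-((n : ℝ) ^ 2)⁻¹ * x) : ℂ)

lemma norm_moebius_le_one (n : ℕ) : ‖(ArithmeticFunction.moebius n : ℂ)‖ ≤ 1 := by
  rw [Complex.norm_intCast]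
  exact_mod_cast ArithmeticFunction.abs_moebius_le_one

lemma norm_moebius_div_sq_le (n : ℕ) :
    ‖(ArithmeticFunction.moebius n : ℂ) / (n : ℂ) ^ 2‖ ≤ 1 / (n : ℝ) ^ 2 := by
  rw [norm_div, norm_pow, Complex.norm_natCast]
  gcongr
  exact norm_moebius_le_one n

lemma norm_rieszKernel_term_le (n : ℕ) {x : ℝ} (hx : 0 ≤ x) :
    ‖(ArithmeticFunction.moebius n : ℂ) / (n : ℂ) ^ 2 *
      (Real.exp (-((n : ℝ) ^ 2)⁻¹ * x) : ℂ)‖ ≤ 1 / (n : ℝ) ^ 2 := by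
  rw [norm_mul, Complex.norm_real, Real.norm_of_nonneg (Real.exp_nonneg _)]
  have h : Real.exp (-((n : ℝ) ^ 2)⁻¹ * x) ≤ 1 := by
    rw [Real.exp_le_one_iff, neg_mul]
    exact neg_nonpos.2 (by positivity)
  calc _ ≤ 1 / (n : ℝ) ^ 2 * 1 := by gcongr; exact norm_moebius_div_sq_le n
    _ = _ := mul_one _

lemma summable_one_div_sq : Summable fun n : ℕ => 1 / (n : ℝ) ^ 2 :=
  Real.summable_one_div_nat_pow.2 one_lt_two

lemma hasSum_rieszKernel {x : ℝ} (hx : 0 ≤ x) :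
    HasSum (fun n : ℕ => (ArithmeticFunction.moebius n : ℂ) / (n : ℂ) ^ 2 *
      (Real.exp (-((n : ℝ) ^ 2)⁻¹ * x) : ℂ)) (rieszKernel x) :=
  (summable_one_div_sq.of_norm_bounded fun n => norm_rieszKernel_term_le n hx).hasSum

lemma continuousOn_rieszKernel : ContinuousOn rieszKernel (Set.Ici 0) := by
  refine continuousOn_tsum (fun n => ?_) summable_one_div_sq
    fun n x hx => norm_rieszKernel_term_le n hx
  fun_prop

lemma exp_neg_le_rpow_neg {a y : ℝ} (ha₀ : 0 ≤ a) (ha₁ : a ≤ 1) (hy : 0 < y) :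
    Real.exp (-y) ≤ y ^ (-a) := by
  rw [Real.exp_neg, Real.rpow_neg hy.le]
  gcongr
  calc y ^ a ≤ (1 + y) ^ a := by gcongr; linarith
    _ ≤ (1 + y) ^ (1 : ℝ) := Real.rpow_le_rpow_of_exponent_le (by linarith) ha₁
    _ ≤ Real.exp y := by rw [Real.rpow_one, add_comm]; exact Real.add_one_le_exp y

lemma exists_norm_rieszKernel_le {a : ℝ} (ha₀ : 0 ≤ a) (ha₁ : a < 1 / 2) :
    ∃ C : ℝ, ∀ x : ℝ, 0 < x → ‖rieszKernel x‖ ≤ C * x ^ (-a) := by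
  have hs : Summable fun n : ℕ => 1 / (n : ℝ) ^ (2 - 2 * a) :=
    Real.summable_one_div_nat_rpow.2 (by linarith)
  refine ⟨∑' n : ℕ, 1 / (n : ℝ) ^ (2 - 2 * a), fun x hx => ?_⟩
  rw [← tsum_mul_right]
  refine tsum_of_norm_bounded (hs.mul_right _).hasSum fun n => ?_
  rcases Nat.eq_zero_or_pos n with rfl | hn
  · simp only [ArithmeticFunction.map_zero, Int.cast_zero, zero_div, zero_mul, norm_zero]
    positivity
  have hn' : (0 : ℝ) < n := Nat.cast_pos.2 hn
  rw [norm_mul, Complex.norm_real, Real.norm_of_nonneg (Real.exp_nonneg _), neg_mul]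
  calc _ ≤ 1 / (n : ℝ) ^ 2 * (((n : ℝ) ^ 2)⁻¹ * x) ^ (-a) := by
        gcongr
        · exact norm_moebius_div_sq_le n
        · exact exp_neg_le_rpow_neg ha₀ (by linarith) (by positivity)
    _ = _ := by
        rw [Real.mul_rpow (by positivity) hx.le, ← mul_assoc]
        congr 1
        rw [Real.inv_rpow (by positivity), Real.rpow_neg (by positivity), inv_inv,
          ← Real.rpow_natCast, ← Real.rpow_mul hn'.le, Real.rpow_sub hn']
        push_cast
        field_simp

lemma hasSum_moebius_div_cpow {s : ℂ} (hs : 1 < s.re) :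
    HasSum (fun n : ℕ => (ArithmeticFunction.moebius n : ℂ) / (n : ℂ) ^ s) (riemannZeta s)⁻¹ := by
  have h := (ArithmeticFunction.LSeriesSummable_moebius_iff.2 hs).LSeriesHasSum
  have h2 := ArithmeticFunction.LSeries_zeta_mul_Lseries_moebius hs
  rw [ArithmeticFunction.LSeries_zeta_eq_riemannZeta hs] at h2
  rw [inv_eq_of_mul_eq_one_right h2]
  refine h.congr_fun ?_
  intro n
  rcases eq_or_ne n 0 with rfl | hn
  · simp
  · rw [LSeries.term_of_ne_zero hn]

lemma mellin_rieszKernel {s : ℂ} (hs₀ : 0 < s.re) (hs₁ : s.re < 1 / 2) :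
    mellin rieszKernel s = Gamma s / riemannZeta (2 - 2 * s) := by
  have key := hasSum_mellin (a := fun n : ℕ => (ArithmeticFunction.moebius n : ℂ) / (n : ℂ) ^ 2)
    (p := fun n : ℕ => ((n : ℝ) ^ 2)⁻¹) (F := rieszKernel) (s := s) ?_ hs₀ ?_ ?_
  · refine key.unique ?_
    rw [div_eq_mul_inv]
    refine ((hasSum_moebius_div_cpow (s := 2 - 2 * s) ?_).mul_left (Gamma s)).congr_fun fun n => ?_
    · simp; linarith
    rw [mul_div_assoc]
    congr 1
    rcases eq_or_ne n 0 with rfl | hn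
    · simp
    have hn' : (n : ℂ) ≠ 0 := Nat.cast_ne_zero.2 hn
    have h1 : ((((n : ℝ) ^ 2)⁻¹ : ℝ) : ℂ) ^ s = ((n : ℂ) ^ (2 * s))⁻¹ := by
      rw [Complex.ofReal_inv, Complex.inv_cpow _ _ ?_, two_mul, Complex.cpow_add _ _ hn',
        ← Complex.natCast_mul_natCast_cpow, Complex.ofReal_pow, Complex.ofReal_natCast, sq]
      rw [Complex.arg_ofReal_of_nonneg (by positivity)]
      exact Real.pi_pos.ne
    rw [h1, Complex.cpow_sub _ _ hn', Complex.cpow_ofNat]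
    field_simp
  · intro n
    rcases Nat.eq_zero_or_pos n with rfl | hn
    · simp
    · right; positivity
  · intro t ht
    exact hasSum_rieszKernel (le_of_lt ht)
  · have hsum : Summable fun n : ℕ => 1 / (n : ℝ) ^ (2 - 2 * s.re) :=
      Real.summable_one_div_nat_rpow.2 (by linarith)
    refine Summable.of_nonneg_of_le (fun n => by positivity) (fun n => ?_) hsum
    rcases Nat.eq_zero_or_pos n with rfl | hn
    · simp; positivity
    have hn' : (0 : ℝ) < n := Nat.cast_pos.2 hn
    calc _ ≤ 1 / (n : ℝ) ^ 2 / (((n : ℝ) ^ 2)⁻¹) ^ s.re := by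
          gcongr; exact norm_moebius_div_sq_le n
      _ = _ := by
        rw [Real.inv_rpow (by positivity),
          ← Real.rpow_natCast, ← Real.rpow_mul hn'.le, Real.rpow_sub hn']
        push_cast
        field_simp


lemma riesz_eq_mul_rieszKernel {x : ℝ} (hx : 0 ≤ x) :
    ∑' k : ℕ, (-1 : ℂ) ^ k * (x : ℂ) ^ (k + 1) /
      ((Nat.factorial k : ℂ) * riemannZeta (2 * ((k : ℂ) + 1))) = x * rieszKernel x := by
  let f : ℕ → ℕ → ℂ := fun n k =>
    (ArithmeticFunction.moebius n : ℂ) / (n : ℂ) ^ 2 * ((-((n : ℂ) ^ 2)⁻¹ * x) ^ k / k.factorial)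
  have hf : Summable (Function.uncurry f) := by
    have h1 := summable_one_div_sq.mul_of_nonneg (Real.summable_pow_div_factorial x)
      (fun n => by positivity) (fun n => by positivity)
    refine h1.of_norm_bounded fun ⟨n, k⟩ => ?_
    simp only [Function.uncurry_apply_pair, f]
    rw [norm_mul]
    gcongr
    · exact norm_moebius_div_sq_le n
    · rw [norm_div, norm_pow, Complex.norm_natCast, norm_mul, norm_neg, norm_inv, norm_pow,
        Complex.norm_natCast, Complex.norm_real, Real.norm_of_nonneg hx]
      gcongr
      refine mul_le_of_le_one_left hx ?_
      rcases Nat.eq_zero_or_pos n with rfl | hn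
      · simp
      · exact inv_le_one_of_one_le₀ (one_le_pow₀ (by exact_mod_cast hn))
  have h1 : rieszKernel x = ∑' n, ∑' k, f n k := by
    refine tsum_congr fun n => ?_
    rw [tsum_mul_left]
    congr 1
    rw [Complex.ofReal_exp, Complex.exp_eq_exp_ℂ, NormedSpace.exp_eq_tsum_div]
    push_cast
    rfl
  rw [h1, ← hf.tsum_comm, ← tsum_mul_left]
  refine tsum_congr fun k => ?_
  have h2 : HasSum (fun n => f n k)
      ((riemannZeta (2 * ((k : ℂ) + 1)))⁻¹ * ((-1) ^ k * x ^ k / k.factorial)) := by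
    refine ((hasSum_moebius_div_cpow (s := 2 * ((k : ℂ) + 1)) ?_).mul_right _).congr_fun fun n => ?_
    · simp; linarith [(Nat.cast_nonneg k : (0 : ℝ) ≤ k)]
    simp only [f]
    rcases eq_or_ne n 0 with rfl | hn
    · simp
    have hn' : (n : ℂ) ≠ 0 := Nat.cast_ne_zero.2 hn
    have h3 : (n : ℂ) ^ (2 * ((k : ℂ) + 1)) = (n : ℂ) ^ (2 * (k + 1)) := by
      rw [← Complex.cpow_natCast]; push_cast; rfl
    rw [h3, neg_mul, neg_pow, mul_pow, inv_pow, ← pow_mul, mul_add, pow_add]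
    field_simp
    ring
  rw [h2.tsum_eq, pow_succ]
  field_simp

/-- The entire function `(s - 1) * ζ(s)`. -/
noncomputable def subOneMulZeta : ℂ → ℂ :=
  Function.update (fun s => (s - 1) * riemannZeta s) 1 1

lemma subOneMulZeta_of_ne {s : ℂ} (hs : s ≠ 1) : subOneMulZeta s = (s - 1) * riemannZeta s :=
  Function.update_of_ne hs ..

lemma subOneMulZeta_one : subOneMulZeta 1 = 1 := Function.update_self ..

lemma differentiable_subOneMulZeta : Differentiable ℂ subOneMulZeta := by
  rw [← differentiableOn_univ,
    ← differentiableOn_compl_singleton_and_continuousAt_iff (c := 1) Filter.univ_mem]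
  refine ⟨fun s hs => ?_, continuousAt_update_same.2 riemannZeta_residue_one⟩
  have hs' : s ≠ 1 := hs.2
  have h : DifferentiableAt ℂ (fun s => (s - 1) * riemannZeta s) s :=
    (by fun_prop : DifferentiableAt ℂ (fun s : ℂ => s - 1) s).mul (differentiableAt_riemannZeta hs')
  refine (h.congr_of_eventuallyEq ?_).differentiableWithinAt
  filter_upwards [eventually_ne_nhds hs'] with t ht using subOneMulZeta_of_ne ht

/-- The fractional part function on `(1, ∞)`, extended by zero. -/
noncomputable def fractTail (t : ℝ) : ℂ :=
  (Set.Ioi (1 : ℝ)).indicator (fun t => ((Int.fract t : ℝ) : ℂ)) t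

lemma norm_fractTail_le (t : ℝ) : ‖fractTail t‖ ≤ 1 := by
  rw [fractTail, Set.indicator_apply]
  split_ifs
  · rw [Complex.norm_real, Real.norm_of_nonneg (Int.fract_nonneg t)]
    exact (Int.fract_lt_one t).le
  · simp

lemma measurable_fractTail : Measurable fractTail :=
  (Complex.measurable_ofReal.comp measurable_fract).indicator measurableSet_Ioi

lemma locallyIntegrableOn_fractTail : MeasureTheory.LocallyIntegrableOn fractTail (Set.Ioi 0) := by
  refine MeasureTheory.LocallyIntegrable.locallyIntegrableOn ?_ _
  refine (MeasureTheory.locallyIntegrable_const (1 : ℝ)).mono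
    measurable_fractTail.aestronglyMeasurable (Eventually.of_forall fun t => ?_)
  simpa using norm_fractTail_le t

lemma differentiableAt_mellin_fractTail {s : ℂ} (hs : s.re < 0) :
    DifferentiableAt ℂ (mellin fractTail) s := by
  refine mellin_differentiableAt_of_isBigO_rpow (a := 0) (b := s.re - 1)
    locallyIntegrableOn_fractTail ?_ hs ?_ (by linarith)
  · refine IsBigO.of_bound 1 (Eventually.of_forall fun t => ?_)
    simpa using norm_fractTail_le t
  · refine IsBigO.of_bound 1 ?_
    filter_upwards [mem_nhdsWithin_of_mem_nhds (Iio_mem_nhds (zero_lt_one' ℝ))] with t ht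
    rw [fractTail, Set.indicator_of_notMem (by simpa using (le_of_lt ht))]
    simp

lemma mellin_fractTail_eq (s : ℂ) :
    mellin fractTail (-s) =
      ∫ t in Set.Ioi (1 : ℝ), ((Int.fract t : ℝ) : ℂ) * (t : ℂ) ^ (-(s + 1)) := by
  rw [mellin, ← MeasureTheory.integral_indicator measurableSet_Ioi,
    ← MeasureTheory.integral_indicator measurableSet_Ioi]
  congr 1
  ext t
  simp only [Set.indicator_apply, fractTail, Set.mem_Ioi, smul_eq_mul]
  by_cases h1 : 1 < t
  · rw [if_pos (by linarith), if_pos h1, if_pos h1, mul_comm, neg_add']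
  · simp [h1]

lemma norm_mellin_fractTail_le {s : ℂ} (hs : 0 < s.re) :
    ‖mellin fractTail (-s)‖ ≤ 1 / s.re := by
  rw [mellin_fractTail_eq]
  have h := integral_Ioi_rpow_of_lt (a := -(s.re + 1)) (by linarith) (zero_lt_one' ℝ)
  have h' : ∫ t in Set.Ioi (1 : ℝ), t ^ (-(s.re + 1)) = 1 / s.re := by
    rw [h, Real.one_rpow, neg_add, neg_add_cancel_right, neg_div_neg_eq]
  rw [← h']
  refine MeasureTheory.norm_integral_le_of_norm_le
    (integrableOn_Ioi_rpow_of_lt (by linarith) zero_lt_one) ?_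
  filter_upwards [MeasureTheory.ae_restrict_mem measurableSet_Ioi] with t ht
  have ht' : (0 : ℝ) < t := zero_lt_one.trans ht
  rw [norm_mul, Complex.norm_cpow_eq_rpow_re_of_pos ht', Complex.norm_real,
    Real.norm_of_nonneg (Int.fract_nonneg t)]
  simp only [neg_re, add_re, one_re]
  exact mul_le_of_le_one_left (by positivity) (Int.fract_lt_one t).le

lemma riemannZeta_eq_sub_mellin_fractTail {s : ℂ} (hs : 1 < s.re) :
    riemannZeta s = s / (s - 1) - s * mellin fractTail (-s) := by
  have hs1 : s - 1 ≠ 0 := fun h => by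
    have := congrArg re h
    simp at this; linarith
  have h1 := LSeries_eq_mul_integral_of_nonneg (fun _ => 1) zero_le_one hs (by
      simpa using isBigO_refl _ _) (fun _ => zero_le_one)
  have h2 : LSeries (fun _ : ℕ => ((1 : ℝ) : ℂ)) s = riemannZeta s := by
    rw [← ArithmeticFunction.LSeries_zeta_eq_riemannZeta hs,
      ArithmeticFunction.LSeries_zeta_eq]
    simp; rfl
  rw [← h2, h1, mellin_fractTail_eq]
  have h3 := integral_Ioi_cpow_of_lt (a := -s) (by simpa using hs) (zero_lt_one' ℝ)
  have i3 := integrableOn_Ioi_cpow_of_lt (a := -s) (by simpa using hs) (zero_lt_one' ℝ)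
  have i4 : MeasureTheory.IntegrableOn
      (fun t : ℝ => ((Int.fract t : ℝ) : ℂ) * (t : ℂ) ^ (-(s + 1))) (Set.Ioi 1) := by
    refine (integrableOn_Ioi_cpow_of_lt (a := -(s + 1)) (by simp; linarith)
      (zero_lt_one' ℝ)).bdd_mul (c := 1)
        (Complex.measurable_ofReal.comp measurable_fract).aestronglyMeasurable
        (Eventually.of_forall fun t => ?_)
    rw [Complex.norm_real, Real.norm_of_nonneg (Int.fract_nonneg t)]
    exact (Int.fract_lt_one t).le
  have h5 : ∫ t in Set.Ioi (1 : ℝ), (∑ k ∈ Finset.Icc 1 ⌊t⌋₊, ((1 : ℝ) : ℂ)) * (t : ℂ) ^ (-(s + 1))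
      = (∫ t in Set.Ioi (1 : ℝ), (t : ℂ) ^ (-s)) -
        ∫ t in Set.Ioi (1 : ℝ), ((Int.fract t : ℝ) : ℂ) * (t : ℂ) ^ (-(s + 1)) := by
    rw [← MeasureTheory.integral_sub i3 i4]
    refine MeasureTheory.setIntegral_congr_fun measurableSet_Ioi fun t ht => ?_
    have ht0 : (0 : ℝ) < t := zero_lt_one.trans ht
    have ht' : (t : ℂ) ≠ 0 := Complex.ofReal_ne_zero.2 ht0.ne'
    have hfl : ((⌊t⌋₊ : ℝ)) = t - Int.fract t := by
      rw [natCast_floor_eq_intCast_floor ht0.le, Int.self_sub_fract]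
    have hfl' : ((⌊t⌋₊ : ℂ)) = t - Int.fract t := by exact_mod_cast congrArg Complex.ofReal hfl
    have hp : (t : ℂ) ^ (-s) = t * (t : ℂ) ^ (-(s + 1)) := by
      rw [neg_add, Complex.cpow_add _ _ ht', Complex.cpow_neg_one]; field_simp
    simp only [Complex.ofReal_one, Finset.sum_const, Nat.card_Icc, add_tsub_cancel_right,
      nsmul_eq_mul, mul_one]
    rw [hfl', hp]; ring
  rw [h5, h3, Complex.ofReal_one, Complex.one_cpow, mul_sub]
  congr 1
  have : -s + 1 ≠ 0 := by rw [← neg_ne_zero]; convert hs1 using 1; ring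
  field_simp
  ring

lemma subOneMulZeta_eq {s : ℂ} (hs : 0 < s.re) :
    subOneMulZeta s = s - s * (s - 1) * mellin fractTail (-s) := by
  have hopen : IsOpen {s : ℂ | 0 < s.re} := isOpen_lt continuous_const continuous_re
  have h1 : AnalyticOnNhd ℂ subOneMulZeta {s : ℂ | 0 < s.re} :=
    differentiable_subOneMulZeta.differentiableOn.analyticOnNhd hopen
  have h2 : AnalyticOnNhd ℂ (fun s => s - s * (s - 1) * mellin fractTail (-s))
      {s : ℂ | 0 < s.re} := by
    refine DifferentiableOn.analyticOnNhd (fun z hz => ?_) hopen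
    have hz' : (-z).re < 0 := by simpa using hz
    have : DifferentiableAt ℂ (fun s => mellin fractTail (-s)) z :=
      DifferentiableAt.comp (g := mellin fractTail) (f := fun s => -s) z
        (differentiableAt_mellin_fractTail hz') differentiable_neg.differentiableAt
    exact (by fun_prop : DifferentiableAt ℂ (fun s => s - s * (s - 1) * mellin fractTail (-s))
      z).differentiableWithinAt
  refine h1.eqOn_of_preconnected_of_eventuallyEq h2 (convex_halfSpace_re_gt 0).isPreconnected
    (z₀ := 2) (by simp) ?_ hs
  filter_upwards [(isOpen_lt continuous_const continuous_re).mem_nhds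
    (by simp : (2 : ℂ) ∈ {s : ℂ | 1 < s.re})] with z (hz : 1 < z.re)
  have hz1 : z ≠ 1 := by rintro rfl; simp at hz
  have hz2 : z - 1 ≠ 0 := sub_ne_zero.2 hz1
  rw [subOneMulZeta_of_ne hz1, riemannZeta_eq_sub_mellin_fractTail hz]
  field_simp

lemma norm_subOneMulZeta_le {s : ℂ} (hs : 1 / 2 ≤ s.re) :
    ‖subOneMulZeta s‖ ≤ 2 * (1 + ‖s‖) ^ 2 := by
  rw [subOneMulZeta_eq (by linarith)]
  have h1 : ‖mellin fractTail (-s)‖ ≤ 2 := by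
    refine (norm_mellin_fractTail_le (by linarith)).trans ?_
    rw [div_le_iff₀ (by linarith)]; linarith
  have h2 : ‖s - 1‖ ≤ ‖s‖ + 1 := by simpa using norm_sub_le s 1
  calc _ ≤ ‖s‖ + ‖s‖ * ‖s - 1‖ * ‖mellin fractTail (-s)‖ := by
        refine (norm_sub_le _ _).trans ?_
        rw [norm_mul, norm_mul]
    _ ≤ ‖s‖ + ‖s‖ * (‖s‖ + 1) * 2 := by gcongr
    _ ≤ _ := by nlinarith [norm_nonneg s]

lemma rieszKernel_isBigO_of_mul {ε : ℝ}
    (h : (fun x : ℝ => (x : ℂ) * rieszKernel x) =O[atTop] fun x : ℝ => x ^ (1 / 4 + ε : ℝ)) :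
    rieszKernel =O[atTop] fun x : ℝ => x ^ (-(3 / 4 - ε) : ℝ) := by
  have h1 : (fun x : ℝ => ((x : ℂ))⁻¹) =O[atTop] fun x : ℝ => x⁻¹ :=
    IsBigO.of_bound 1 (Eventually.of_forall fun x => by simp)
  refine (h1.mul h).congr' ?_ ?_
  · filter_upwards [eventually_gt_atTop 0] with x hx
    have : (x : ℂ) ≠ 0 := Complex.ofReal_ne_zero.2 hx.ne'
    field_simp
  · filter_upwards [eventually_gt_atTop 0] with x hx
    rw [← Real.rpow_neg_one, ← Real.rpow_add hx]
    congr 1; ring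

lemma subOneMulZeta_ne_zero_of_one_le_re {z : ℂ} (hz : 1 ≤ z.re) : subOneMulZeta z ≠ 0 := by
  rcases eq_or_ne z 1 with rfl | h1
  · simp [subOneMulZeta_one]
  · rw [subOneMulZeta_of_ne h1]
    exact mul_ne_zero (sub_ne_zero.2 h1) (riemannZeta_ne_zero_of_one_le_re hz)

lemma locallyIntegrableOn_rieszKernel :
    MeasureTheory.LocallyIntegrableOn rieszKernel (Set.Ioi 0) :=
  (continuousOn_rieszKernel.mono Set.Ioi_subset_Ici_self).locallyIntegrableOn measurableSet_Ioi

lemma rieszKernel_isBigO_nhds_zero :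
    rieszKernel =O[nhdsWithin 0 (Set.Ioi 0)] fun x : ℝ => x ^ (-0 : ℝ) := by
  obtain ⟨C, hC⟩ := exists_norm_rieszKernel_le le_rfl (by norm_num)
  refine IsBigO.of_bound C ?_
  filter_upwards [self_mem_nhdsWithin] with x hx
  simpa using hC x hx

lemma mellin_rieszKernel_mul_subOneMulZeta {a : ℝ}
    (h : rieszKernel =O[atTop] fun x : ℝ => x ^ (-a)) {s : ℂ} (hs₀ : 0 < s.re) (hs₁ : s.re < a) :
    mellin rieszKernel s * subOneMulZeta (2 - 2 * s) = (1 - 2 * s) * Gamma s := by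
  set U : Set ℂ := {s : ℂ | 0 < s.re} ∩ {s : ℂ | s.re < a} with hU
  have hopen : IsOpen U :=
    (isOpen_lt continuous_const continuous_re).inter (isOpen_lt continuous_re continuous_const)
  have hconv : Convex ℝ U := (convex_halfSpace_re_gt 0).inter (convex_halfSpace_re_lt a)
  have h1 : AnalyticOnNhd ℂ (fun s => mellin rieszKernel s * subOneMulZeta (2 - 2 * s)) U := by
    refine DifferentiableOn.analyticOnNhd (fun z hz => ?_) hopen
    have d1 : DifferentiableAt ℂ (mellin rieszKernel) z :=
      mellin_differentiableAt_of_isBigO_rpow locallyIntegrableOn_rieszKernel h hz.2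
        rieszKernel_isBigO_nhds_zero hz.1
    have d2 : Differentiable ℂ fun s : ℂ => subOneMulZeta (2 - 2 * s) :=
      differentiable_subOneMulZeta.comp (by fun_prop)
    exact (d1.mul (d2 z)).differentiableWithinAt
  have h2 : AnalyticOnNhd ℂ (fun s => (1 - 2 * s) * Gamma s) U := by
    refine DifferentiableOn.analyticOnNhd (fun z hz => ?_) hopen
    have d1 : DifferentiableAt ℂ Gamma z := by
      refine differentiableAt_Gamma z fun m hm => ?_
      have := hz.1
      simp only [hm, Set.mem_ofPred_eq, neg_re, natCast_re] at this
      linarith [(Nat.cast_nonneg m : (0 : ℝ) ≤ m)]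
    exact (by fun_prop : DifferentiableAt ℂ (fun s => (1 - 2 * s) * Gamma s)
      z).differentiableWithinAt
  obtain ⟨c, hc₀, hc₁⟩ : ∃ c : ℝ, 0 < c ∧ c < min a (1 / 2) :=
    exists_between (lt_min (hs₀.trans hs₁) (by norm_num))
  refine h1.eqOn_of_preconnected_of_eventuallyEq h2 hconv.isPreconnected (z₀ := (c : ℂ))
    ⟨by simpa using hc₀, by simpa using hc₁.trans_le (min_le_left _ _)⟩ ?_ ⟨hs₀, hs₁⟩
  have hn : {s : ℂ | 0 < s.re} ∩ {s : ℂ | s.re < 1 / 2} ∈ nhds (c : ℂ) :=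
    ((isOpen_lt continuous_const continuous_re).inter
      (isOpen_lt continuous_re continuous_const)).mem_nhds
      ⟨by simpa using hc₀, by simpa using hc₁.trans_le (min_le_right _ _)⟩
  filter_upwards [hn] with z hz
  have hz₁ : z.re < 1 / 2 := hz.2
  have hre : 1 < (2 - 2 * z).re := by simp; linarith
  rw [mellin_rieszKernel hz.1 hz.2, subOneMulZeta_of_ne (by rintro h; simp [h] at hre)]
  rw [show (2 - 2 * z - 1) = 1 - 2 * z by ring]
  have := riemannZeta_ne_zero_of_one_le_re hre.le
  rw [mul_comm (1 - 2 * z), ← mul_assoc, div_mul_cancel₀ _ this, mul_comm]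

lemma subOneMulZeta_ne_zero_of_isBigO
    (h : ∀ ε : ℝ, 0 < ε → rieszKernel =O[atTop] fun x : ℝ => x ^ (-(3 / 4 - ε) : ℝ))
    {z : ℂ} (hz : 1 / 2 < z.re) : subOneMulZeta z ≠ 0 := by
  rcases le_or_gt 1 z.re with h1 | h1
  · exact subOneMulZeta_ne_zero_of_one_le_re h1
  intro h0
  have hre : (1 - z / 2).re = 1 - z.re / 2 := by simp
  have key := mellin_rieszKernel_mul_subOneMulZeta (h ((z.re - 1 / 2) / 4) (by linarith))
    (s := 1 - z / 2) (by rw [hre]; linarith) (by rw [hre]; linarith)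
  rw [show 2 - 2 * (1 - z / 2) = z by ring, h0, mul_zero, eq_comm, mul_eq_zero] at key
  rcases key with key | key
  · have : z = 1 := by linear_combination key
    simp [this] at h1
  · exact Gamma_ne_zero_of_re_pos (by rw [hre]; linarith) key

lemma riemannZeta_neg_odd_ne_zero (m : ℕ) : riemannZeta (-(2 * m + 1 : ℕ)) ≠ 0 := by
  have h := riemannZeta_one_sub (s := (2 * m + 2 : ℕ))
    (fun n hn => by
      have := congrArg re hn
      simp only [natCast_re, neg_re] at this
      have h2 : ((2 * m + 2 : ℕ) : ℝ) + n = 0 := by linarith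
      norm_cast at h2
      omega)
    (by norm_cast; omega)
  rw [show (1 : ℂ) - (2 * m + 2 : ℕ) = -(2 * m + 1 : ℕ) by push_cast; ring] at h
  rw [h]
  refine mul_ne_zero (mul_ne_zero (mul_ne_zero (mul_ne_zero two_ne_zero ?_) ?_) ?_) ?_
  · rw [Complex.cpow_ne_zero_iff]
    left
    norm_num [Real.pi_ne_zero]
  · exact Gamma_ne_zero_of_re_pos (by rw [natCast_re]; positivity)
  · rw [show (Real.pi : ℂ) * (2 * m + 2 : ℕ) / 2 = (m + 1 : ℕ) * Real.pi by push_cast; ring,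
      ← Complex.ofReal_natCast, ← Complex.ofReal_mul, ← Complex.ofReal_cos, Real.cos_nat_mul_pi]
    exact Complex.ofReal_ne_zero.2 (pow_ne_zero _ (by norm_num))
  · refine riemannZeta_ne_zero_of_one_le_re ?_
    rw [natCast_re]; norm_cast; omega

lemma riemannHypothesis_iff_subOneMulZeta_ne_zero :
    RiemannHypothesis ↔ ∀ z : ℂ, 1 / 2 < z.re → subOneMulZeta z ≠ 0 := by
  constructor
  · intro h z hz h0
    have hz1 : z ≠ 1 := by rintro rfl; simp [subOneMulZeta_one] at h0
    rw [subOneMulZeta_of_ne hz1, mul_eq_zero, or_iff_right (sub_ne_zero.2 hz1)] at h0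
    refine hz.ne' (h z h0 ?_ hz1)
    rintro ⟨n, rfl⟩
    simp at hz
    linarith [(Nat.cast_nonneg n : (0 : ℝ) ≤ n)]
  · intro h
    have h' : ∀ z : ℂ, 1 / 2 < z.re → riemannZeta z ≠ 0 := by
      intro z hz h0
      rcases eq_or_ne z 1 with rfl | hz1
      · exact riemannZeta_one_ne_zero h0
      · exact h z hz (by rw [subOneMulZeta_of_ne hz1, h0, mul_zero])
    intro s hs htriv hs1
    rcases lt_trichotomy s.re (1 / 2) with hlt | heq | hgt
    · exfalso
      by_cases hn : ∃ n : ℕ, s = -n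
      · obtain ⟨n, rfl⟩ := hn
        rcases Nat.even_or_odd' n with ⟨m, rfl | rfl⟩
        · rcases m with _ | m
          · simp [riemannZeta_zero] at hs
          · exact htriv ⟨m, by push_cast; ring⟩
        · exact riemannZeta_neg_odd_ne_zero m hs
      · push Not at hn
        refine h' (1 - s) (by simp; linarith) ?_
        rw [riemannZeta_one_sub hn hs1, hs, mul_zero]
    · exact heq
    · exact absurd hs (h' s hgt)

lemma exists_exp_mul_eq_on_ball {f : ℂ → ℂ} {c : ℂ} {r : ℝ}
    (hf : DifferentiableOn ℂ f (Metric.ball c r)) (h0 : ∀ z ∈ Metric.ball c r, f z ≠ 0) :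
    ∃ g : ℂ → ℂ, g c = 0 ∧ DifferentiableOn ℂ g (Metric.ball c r) ∧
      ∀ z ∈ Metric.ball c r, exp (g z) * f c = f z := by
  have hd : DifferentiableOn ℂ (fun z => deriv f z / f z) (Metric.ball c r) :=
    (hf.deriv Metric.isOpen_ball).div hf h0
  obtain ⟨g, hgc, hg⟩ := hd.isExactOn_ball.with_val_at c 0
  have hgd : DifferentiableOn ℂ g (Metric.ball c r) := fun z hz =>
    (hg z hz).differentiableAt.differentiableWithinAt
  refine ⟨g, hgc, hgd, fun z hz => ?_⟩
  have hder : ∀ w ∈ Metric.ball c r, HasDerivAt (fun w => f w * exp (-g w)) 0 w := by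
    intro w hw
    have h1 := (hf.differentiableAt (Metric.isOpen_ball.mem_nhds hw)).hasDerivAt
    have h2 := h1.mul (hg w hw).neg.cexp
    refine h2.congr_deriv ?_
    have := h0 w hw
    field_simp
    ring
  have hconst := Metric.isOpen_ball.is_const_of_deriv_eq_zero
    (convex_ball c r).isPreconnected
    (fun w hw => (hder w hw).differentiableAt.differentiableWithinAt)
    (fun w hw => (hder w hw).deriv) hz
    (Metric.mem_ball_self (Metric.pos_of_mem_ball hz))
  simp only [hgc, neg_zero, exp_zero, mul_one] at hconst
  rw [← hconst, mul_comm, mul_assoc, ← Complex.exp_add, neg_add_cancel, Complex.exp_zero, mul_one]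

/-- If `f` is holomorphic, zero-free and bounded on a ball, then `1 / f` is bounded on smaller
concentric balls in terms of the bound for `f` and the value of `f` at the centre. -/
lemma norm_inv_le_of_forall_ne_zero_on_ball {f : ℂ → ℂ} {c : ℂ} {r δ B : ℝ} (hδ : 0 < δ)
    (hf : DifferentiableOn ℂ f (Metric.ball c r)) (h0 : ∀ z ∈ Metric.ball c r, f z ≠ 0)
    (hB : ∀ z ∈ Metric.ball c r, ‖f z‖ ≤ B * ‖f c‖) (hB1 : 1 < B) {z : ℂ} (hz : dist z c ≤ r - δ)
    {N : ℕ} (hN : 2 * r / δ ≤ N) : ‖(f z)⁻¹‖ ≤ ‖(f c)⁻¹‖ * B ^ N := by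
  have hr : 0 < r := by linarith [dist_nonneg (x := z) (y := c)]
  have hzb : z ∈ Metric.ball c r := by rw [Metric.mem_ball]; linarith
  have hfc : f c ≠ 0 := h0 c (Metric.mem_ball_self hr)
  have hfc' : 0 < ‖f c‖ := norm_pos_iff.2 hfc
  obtain ⟨g, hgc, hgd, hg⟩ := exists_exp_mul_eq_on_ball hf h0
  have hM : 0 < Real.log B := Real.log_pos hB1
  have hmaps : ∀ w ∈ Metric.ball (0 : ℂ) r, c + w ∈ Metric.ball c r := by
    intro w hw
    simpa [Metric.mem_ball, dist_eq_norm] using hw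
  have hw : z - c ∈ Metric.ball (0 : ℂ) r := by
    simpa [Metric.mem_ball, dist_eq_norm] using hzb
  have key := borelCaratheodory_zero (f := fun w => g (c + w)) (z := z - c) hM
    (hgd.comp (by fun_prop) hmaps) ?_ hr hw (by simpa using hgc)
  · simp only [add_sub_cancel] at key
    rw [← dist_eq_norm] at key
    have h1 : ‖g z‖ ≤ N * Real.log B := by
      calc _ ≤ 2 * Real.log B * dist z c / (r - dist z c) := key
        _ ≤ 2 * Real.log B * r / δ := by gcongr <;> linarith
        _ = (2 * r / δ) * Real.log B := by ring
        _ ≤ _ := by gcongr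
    rw [← hg z hzb, mul_inv, norm_mul, mul_comm, ← Complex.exp_neg, Complex.norm_exp]
    gcongr
    rw [← Real.exp_log (by linarith : 0 < B), ← Real.exp_nat_mul]
    gcongr
    rw [neg_re]
    exact (neg_le_abs _).trans ((abs_re_le_norm _).trans h1)
  · intro w hw
    have h1 := hB _ (hmaps w hw)
    rw [← hg _ (hmaps w hw), norm_mul, Complex.norm_exp] at h1
    exact (Real.le_log_iff_exp_le (by linarith)).2 (le_of_mul_le_mul_right h1 hfc')

lemma norm_inv_subOneMulZeta_two_add_le (t : ℝ) :
    ‖(subOneMulZeta (2 + t * I))⁻¹‖ ≤ ∑' n : ℕ, 1 / (n : ℝ) ^ 2 := by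
  have hre : (2 + t * I : ℂ).re = 2 := by simp
  have h1 : (2 + t * I : ℂ) ≠ 1 := fun h => by
    have := congrArg re h
    rw [hre] at this; norm_num at this
  rw [subOneMulZeta_of_ne h1, mul_inv, norm_mul]
  have h2 : ‖(riemannZeta (2 + t * I))⁻¹‖ ≤ ∑' n : ℕ, 1 / (n : ℝ) ^ 2 := by
    rw [← (hasSum_moebius_div_cpow (by rw [hre]; norm_num)).tsum_eq]
    refine tsum_of_norm_bounded summable_one_div_sq.hasSum fun n => ?_
    rcases Nat.eq_zero_or_pos n with rfl | hn
    · simp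
    rw [norm_div, Complex.norm_natCast_cpow_of_pos hn, hre, Real.rpow_ofNat]
    gcongr
    exact norm_moebius_le_one n
  have h3 : ‖(2 + t * I - 1 : ℂ)⁻¹‖ ≤ 1 := by
    rw [norm_inv]
    refine inv_le_one_of_one_le₀ ?_
    refine le_trans ?_ (abs_re_le_norm _)
    simp; norm_num
  calc _ ≤ 1 * ∑' n : ℕ, 1 / (n : ℝ) ^ 2 := by gcongr
    _ = _ := one_mul _

/-- If `ζ` has no zeros to the right of the critical line, then `1 / ((s - 1) * ζ(s))` has
polynomial growth on vertical strips strictly to the right of the critical line. -/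
lemma exists_norm_inv_subOneMulZeta_le (h : ∀ z : ℂ, 1 / 2 < z.re → subOneMulZeta z ≠ 0)
    {δ : ℝ} (hδ : 0 < δ) :
    ∃ (C : ℝ) (A : ℕ), 0 ≤ C ∧ ∀ s : ℂ, 1 / 2 + δ ≤ s.re → s.re ≤ 3 / 2 →
      ‖(subOneMulZeta s)⁻¹‖ ≤ C * (1 + |s.im|) ^ A := by
  set K : ℝ := ∑' n : ℕ, 1 / (n : ℝ) ^ 2 with hK
  have hK1 : 1 ≤ K := by
    calc (1 : ℝ) = 1 / ((1 : ℕ) : ℝ) ^ 2 := by norm_num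
      _ ≤ K := summable_one_div_sq.le_tsum 1 fun n _ => by positivity
  obtain ⟨N, hN⟩ := exists_nat_ge (2 * (3 / 2) / δ)
  refine ⟨K * (50 * K) ^ N, 2 * N, by positivity, fun s hs₀ hs₁ => ?_⟩
  set c : ℂ := 2 + s.im * I with hc
  have hcre : c.re = 2 := by simp [hc]
  have hcim : c.im = s.im := by simp [hc]
  have hKc := norm_inv_subOneMulZeta_two_add_le s.im
  rw [← hc, ← hK] at hKc
  have hball : ∀ z ∈ Metric.ball c (3 / 2), 1 / 2 < z.re := by
    intro z hz
    rw [mem_ball_iff_norm] at hz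
    have := (abs_le.1 (abs_re_le_norm (z - c))).1
    rw [sub_re, hcre] at this
    linarith
  have hGc : 1 ≤ K * ‖subOneMulZeta c‖ := by
    have hpos : 0 < ‖subOneMulZeta c‖ := norm_pos_iff.2 (h c (by rw [hcre]; norm_num))
    rwa [norm_inv, inv_le_iff_one_le_mul₀ hpos] at hKc
  have key := norm_inv_le_of_forall_ne_zero_on_ball (f := subOneMulZeta) (c := c) (r := 3 / 2)
    (B := 50 * K * (1 + |s.im|) ^ 2) (z := s) hδ
    differentiable_subOneMulZeta.differentiableOn (fun z hz => h z (hball z hz)) ?_ ?_ ?_ hN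
  · refine key.trans ?_
    rw [mul_pow, ← pow_mul, mul_assoc]
    gcongr
  · intro z hz
    have h1 : ‖z‖ ≤ 7 / 2 + |s.im| := by
      have e1 : ‖c‖ ≤ 2 + |s.im| := by
        simpa [hcre, hcim] using norm_le_abs_re_add_abs_im c
      have e2 : ‖z - c‖ < 3 / 2 := mem_ball_iff_norm.1 hz
      have e3 := norm_sub_norm_le z c
      linarith
    calc ‖subOneMulZeta z‖ ≤ 2 * (1 + ‖z‖) ^ 2 := norm_subOneMulZeta_le (hball z hz).le
      _ ≤ 2 * (5 * (1 + |s.im|)) ^ 2 := by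
          gcongr
          linarith [abs_nonneg s.im]
      _ = 50 * (1 + |s.im|) ^ 2 * 1 := by ring
      _ ≤ 50 * (1 + |s.im|) ^ 2 * (K * ‖subOneMulZeta c‖) := by gcongr
      _ = _ := by ring
  · have : (1 : ℝ) ≤ (1 + |s.im|) ^ 2 := one_le_pow₀ (by linarith [abs_nonneg s.im])
    nlinarith
  · have : s - c = ((s.re - 2 : ℝ) : ℂ) := by
      apply Complex.ext <;> simp [hc]
    rw [dist_eq_norm, this, Complex.norm_real, Real.norm_eq_abs, abs_of_neg (by linarith)]
    linarith

lemma norm_Gamma_le_Gamma_re {s : ℂ} (hs : 0 < s.re) : ‖Gamma s‖ ≤ Real.Gamma s.re := by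
  rw [Complex.Gamma_eq_integral hs, Real.Gamma_eq_integral hs, Complex.GammaIntegral]
  refine (MeasureTheory.norm_integral_le_integral_norm _).trans_eq ?_
  refine MeasureTheory.setIntegral_congr_fun measurableSet_Ioi fun t ht => ?_
  have ht' : (0 : ℝ) < t := ht
  simp only [norm_mul]
  rw [Complex.norm_real, Complex.norm_cpow_eq_rpow_re_of_pos ht',
    Real.norm_of_nonneg (by positivity),
    sub_re, one_re]

lemma norm_pow_mul_norm_Gamma_le {s : ℂ} (hs : 0 < s.re) (N : ℕ) :
    ‖s‖ ^ N * ‖Gamma s‖ ≤ ‖Gamma (s + N)‖ := by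
  induction N with
  | zero => simp
  | succ N ih =>
    have hN : (0 : ℝ) ≤ N := Nat.cast_nonneg N
    have hre : 0 < (s + N).re := by simp; linarith
    have hne : s + N ≠ 0 := fun h => by simp [h] at hre
    have hle : ‖s‖ ≤ ‖s + N‖ := by
      rw [Complex.norm_def, Complex.norm_def]
      apply Real.sqrt_le_sqrt
      simp only [normSq_apply, add_re, add_im, natCast_re, natCast_im, add_zero]
      nlinarith
    rw [Nat.cast_succ, ← add_assoc, Complex.Gamma_add_one _ hne, norm_mul, pow_succ']
    calc _ = ‖s‖ * (‖s‖ ^ N * ‖Gamma s‖) := by ring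
      _ ≤ _ := by gcongr

lemma exists_norm_Gamma_le {a b : ℝ} (ha : 0 < a) (N : ℕ) :
    ∃ C : ℝ, 0 ≤ C ∧ ∀ s : ℂ, a ≤ s.re → s.re ≤ b → (1 + |s.im|) ^ N * ‖Gamma s‖ ≤ C := by
  have hcont : ContinuousOn (fun x : ℝ => Real.Gamma (x + N)) (Set.Icc a b) := by
    intro x hx
    have hd : DifferentiableAt ℝ Real.Gamma (x + N) := by
      refine Real.differentiableAt_Gamma fun m hm => ?_
      have h1 : (0 : ℝ) ≤ N := Nat.cast_nonneg N
      have h2 : (0 : ℝ) ≤ m := Nat.cast_nonneg m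
      linarith [hx.1]
    exact (ContinuousAt.comp (f := fun x : ℝ => x + N) hd.continuousAt
      (by fun_prop)).continuousWithinAt
  obtain ⟨C, hC⟩ := isCompact_Icc.exists_bound_of_continuousOn hcont
  refine ⟨(1 / a + 1) ^ N * |C|, by positivity, fun s hs₀ hs₁ => ?_⟩
  have hre : 0 < s.re := ha.trans_le hs₀
  have h1 : 1 + |s.im| ≤ (1 / a + 1) * ‖s‖ := by
    have e1 := abs_im_le_norm s
    have e2 : a ≤ ‖s‖ := hs₀.trans ((le_abs_self _).trans (abs_re_le_norm s))
    have e3 : 1 ≤ 1 / a * ‖s‖ := by rw [one_div, ← div_eq_inv_mul, one_le_div₀ ha]; exact e2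
    linarith
  have h2 : ‖Gamma (s + N)‖ ≤ |C| := by
    have hpos : 0 < (s + N).re := by
      have : (0 : ℝ) ≤ N := Nat.cast_nonneg N
      simp; linarith
    refine (norm_Gamma_le_Gamma_re hpos).trans ?_
    rw [add_re, natCast_re]
    exact (le_abs_self _).trans ((hC s.re ⟨hs₀, hs₁⟩).trans (le_abs_self C))
  calc _ ≤ ((1 / a + 1) * ‖s‖) ^ N * ‖Gamma s‖ := by gcongr
    _ = (1 / a + 1) ^ N * (‖s‖ ^ N * ‖Gamma s‖) := by rw [mul_pow, mul_assoc]
    _ ≤ _ := by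
      gcongr
      exact (norm_pow_mul_norm_Gamma_le hre N).trans h2

lemma integrable_vertical_line {f : ℂ → ℂ} {a b C σ : ℝ} (hσ : σ ∈ Set.Icc a b)
    (hf : ContinuousOn f (re ⁻¹' Set.Icc a b))
    (hC : ∀ s : ℂ, s.re ∈ Set.Icc a b → ‖f s‖ ≤ C * (1 + s.im ^ 2)⁻¹) :
    MeasureTheory.Integrable fun y : ℝ => f (σ + y * I) := by
  have hre : ∀ y : ℝ, (σ + y * I : ℂ).re = σ := fun y => by simp
  have him : ∀ y : ℝ, (σ + y * I : ℂ).im = y := fun y => by simp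
  have hcont : Continuous fun y : ℝ => f (σ + y * I) :=
    hf.comp_continuous (by fun_prop) fun y => by rw [Set.mem_preimage, hre]; exact hσ
  refine (integrable_inv_one_add_sq.const_mul C).mono' hcont.aestronglyMeasurable ?_
  refine Eventually.of_forall fun y => ?_
  have := hC (σ + y * I) (by rw [hre]; exact hσ)
  rwa [him] at this

lemma integral_vertical_line_eq {f : ℂ → ℂ} {a b C : ℝ} (hab : a ≤ b)
    (hf : DifferentiableOn ℂ f (re ⁻¹' Set.Icc a b))
    (hC : ∀ s : ℂ, s.re ∈ Set.Icc a b → ‖f s‖ ≤ C * (1 + s.im ^ 2)⁻¹) :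
    ∫ y : ℝ, f (a + y * I) = ∫ y : ℝ, f (b + y * I) := by
  have htop := tendsto_id (α := ℝ) (x := atTop)
  have hbot := tendsto_neg_atTop_atBot (G := ℝ)
  have hlim : ∀ σ ∈ Set.Icc a b, Tendsto (fun T : ℝ => ∫ y in (-T)..T, f (σ + y * I)) atTop
      (nhds (∫ y : ℝ, f (σ + y * I))) := fun σ hσ =>
    MeasureTheory.intervalIntegral_tendsto_integral
      (integrable_vertical_line hσ hf.continuousOn hC) hbot htop
  have hdecay : Tendsto (fun T : ℝ => C * (1 + T ^ 2)⁻¹ * |b - a|) atTop (nhds 0) := by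
    have h1 : Tendsto (fun T : ℝ => (1 + T ^ 2)⁻¹) atTop (nhds 0) :=
      tendsto_inv_atTop_zero.comp
        (tendsto_atTop_add_const_left _ _ (tendsto_pow_atTop two_ne_zero))
    simpa using (h1.const_mul C).mul_const |b - a|
  have hhor : ∀ u : ℝ → ℝ, (∀ T, u T ^ 2 = T ^ 2) →
      Tendsto (fun T : ℝ => ∫ x in a..b, f (x + u T * I)) atTop (nhds 0) := by
    intro u hu
    refine squeeze_zero_norm (fun T => ?_) hdecay
    refine intervalIntegral.norm_integral_le_of_norm_le_const fun x hx => ?_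
    rw [Set.uIoc_of_le hab] at hx
    have := hC (x + u T * I) (by simpa using ⟨hx.1.le, hx.2⟩)
    simpa [hu] using this
  have hrect : ∀ T : ℝ, I * (∫ y in (-T)..T, f (b + y * I)) - I * (∫ y in (-T)..T, f (a + y * I)) =
      (∫ x in a..b, f (x + T * I)) - ∫ x in a..b, f (x + (-T : ℝ) * I) := by
    intro T
    have h := integral_boundary_rect_eq_zero_of_differentiableOn f (a + (-T : ℝ) * I) (b + T * I)
      (hf.mono fun s hs => by
        have := hs.1
        simpa [Set.uIcc_of_le hab] using this)
    simp only [add_re, add_im, ofReal_re, ofReal_im, mul_re, mul_im, I_re, I_im, mul_zero, mul_one,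
      sub_zero, zero_add, add_zero, smul_eq_mul] at h
    linear_combination h
  have h1 := ((hlim b ⟨hab, le_rfl⟩).const_mul I).sub ((hlim a ⟨le_rfl, hab⟩).const_mul I)
  have h2 := (hhor (fun T => T) fun _ => rfl).sub (hhor (fun T => -T) fun T => neg_sq T)
  have h3 := tendsto_nhds_unique (h1.congr hrect) h2
  rw [sub_zero, ← mul_sub, mul_eq_zero, or_iff_right I_ne_zero, sub_eq_zero] at h3
  exact h3.symm

/-- The analytic continuation of the Mellin transform of `rieszKernel`. -/
noncomputable def rieszMellin (w : ℂ) : ℂ :=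
  Gamma w * (1 - 2 * w) * (subOneMulZeta (2 - 2 * w))⁻¹

lemma mellin_rieszKernel_eq_rieszMellin {w : ℂ} (hw₀ : 0 < w.re) (hw₁ : w.re < 1 / 2) :
    mellin rieszKernel w = rieszMellin w := by
  have hre : (2 - 2 * w).re = 2 - 2 * w.re := by simp
  have h1 : 2 - 2 * w ≠ 1 := fun h => by
    rw [h, one_re] at hre
    linarith
  have h2 : 1 - 2 * w ≠ 0 := fun h => h1 (by linear_combination h)
  rw [mellin_rieszKernel hw₀ hw₁, rieszMellin, subOneMulZeta_of_ne h1]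
  have h3 : riemannZeta (2 - 2 * w) ≠ 0 := riemannZeta_ne_zero_of_one_le_re (by linarith)
  rw [show 2 - 2 * w - 1 = 1 - 2 * w by ring]
  field_simp

lemma exists_norm_rieszMellin_le (h : ∀ z : ℂ, 1 / 2 < z.re → subOneMulZeta z ≠ 0)
    {ε : ℝ} (hε : 0 < ε) :
    ∃ C : ℝ, 0 ≤ C ∧ ∀ w : ℂ, w.re ∈ Set.Icc (1 / 4) (3 / 4 - ε) →
      ‖rieszMellin w‖ ≤ C * (1 + w.im ^ 2)⁻¹ := by
  obtain ⟨C₁, A, hC₁, h₁⟩ := exists_norm_inv_subOneMulZeta_le h (δ := 2 * ε) (by positivity)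
  obtain ⟨C₂, hC₂, h₂⟩ := exists_norm_Gamma_le (a := 1 / 4) (b := 3 / 4 - ε) (by norm_num) (A + 3)
  refine ⟨C₂ * (3 * (C₁ * 2 ^ A)), by positivity, fun w hw => ?_⟩
  have hre : (2 - 2 * w).re = 2 - 2 * w.re := by simp
  have him : |(2 - 2 * w).im| = 2 * |w.im| := by simp [abs_mul]
  have ht := abs_nonneg w.im
  have b₁ : ‖(subOneMulZeta (2 - 2 * w))⁻¹‖ ≤ C₁ * 2 ^ A * (1 + |w.im|) ^ A := by
    refine (h₁ _ (by rw [hre]; linarith [hw.2]) (by rw [hre]; linarith [hw.1])).trans ?_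
    rw [him, mul_assoc, ← mul_pow]
    gcongr
    linarith
  have b₂ : ‖1 - 2 * w‖ ≤ 3 * (1 + |w.im|) := by
    have e1 := norm_le_abs_re_add_abs_im w
    have e2 : |w.re| ≤ 1 := abs_le.2 ⟨by linarith [hw.1], by linarith [hw.2]⟩
    have e3 : ‖1 - 2 * w‖ ≤ 1 + 2 * ‖w‖ := (norm_sub_le _ _).trans (by simp)
    linarith
  have b₃ := h₂ w hw.1 hw.2
  rw [le_mul_inv_iff₀ (by positivity), rieszMellin, norm_mul, norm_mul]
  calc _ ≤ ‖Gamma w‖ * (3 * (1 + |w.im|)) * (C₁ * 2 ^ A * (1 + |w.im|) ^ A) *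
        (1 + |w.im|) ^ 2 := by
        gcongr
        nlinarith [sq_abs w.im]
    _ = (1 + |w.im|) ^ (A + 3) * ‖Gamma w‖ * (3 * (C₁ * 2 ^ A)) := by ring
    _ ≤ _ := by gcongr

lemma differentiableOn_rieszMellin (h : ∀ z : ℂ, 1 / 2 < z.re → subOneMulZeta z ≠ 0)
    {ε : ℝ} (hε : 0 < ε) :
    DifferentiableOn ℂ rieszMellin (re ⁻¹' Set.Icc (1 / 4) (3 / 4 - ε)) := by
  intro w hw
  have hre : (2 - 2 * w).re = 2 - 2 * w.re := by simp
  have h1 : DifferentiableAt ℂ Gamma w := differentiableAt_Gamma _ fun m hm => by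
    have e1 := congrArg re hm
    have e2 : (0 : ℝ) ≤ m := Nat.cast_nonneg m
    have e3 := hw.1
    simp only [neg_re, natCast_re] at e1
    linarith
  have h2 : DifferentiableAt ℂ (fun w => subOneMulZeta (2 - 2 * w)) w :=
    (differentiable_subOneMulZeta _).comp w (by fun_prop)
  have h3 : subOneMulZeta (2 - 2 * w) ≠ 0 := h _ (by rw [hre]; linarith [hw.2])
  exact ((h1.mul (by fun_prop)).mul (h2.inv h3)).differentiableWithinAt

lemma rieszKernel_eq_mellinInv (h : ∀ z : ℂ, 1 / 2 < z.re → subOneMulZeta z ≠ 0)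
    {x : ℝ} (hx : 0 < x) :
    rieszKernel x =
      (1 / (2 * Real.pi) : ℝ) • ∫ y : ℝ, (x : ℂ) ^ (-((1 / 4 : ℝ) + y * I : ℂ)) *
        rieszMellin ((1 / 4 : ℝ) + y * I) := by
  obtain ⟨K, -, hK⟩ := exists_norm_rieszMellin_le h (ε := 1 / 4) (by norm_num)
  obtain ⟨M, hM⟩ := exists_norm_rieszKernel_le (a := 3 / 8) (by norm_num) (by norm_num)
  have heq : ∀ y : ℝ, mellin rieszKernel ((1 / 4 : ℝ) + y * I) =
      rieszMellin ((1 / 4 : ℝ) + y * I) := fun y =>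
    mellin_rieszKernel_eq_rieszMellin (by simp) (by simp; norm_num)
  have htop : rieszKernel =O[atTop] fun x : ℝ => x ^ (-(3 / 8) : ℝ) := by
    refine IsBigO.of_bound M ?_
    filter_upwards [eventually_gt_atTop 0] with y hy
    rw [Real.norm_of_nonneg (Real.rpow_nonneg hy.le _)]
    exact hM y hy
  have hconv : MellinConvergent rieszKernel (1 / 4 : ℝ) :=
    mellinConvergent_of_isBigO_rpow locallyIntegrableOn_rieszKernel htop
      (by rw [ofReal_re]; norm_num) rieszKernel_isBigO_nhds_zero (by rw [ofReal_re]; norm_num)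
  have hvert : VerticalIntegrable (mellin rieszKernel) (1 / 4 : ℝ) := by
    rw [VerticalIntegrable]
    simp only [heq]
    exact integrable_vertical_line (by norm_num)
      (differentiableOn_rieszMellin h (ε := 1 / 4) (by norm_num)).continuousOn hK
  have := mellinInv_mellin_eq (1 / 4) rieszKernel hx hconv hvert
    (continuousOn_rieszKernel.continuousAt (Ici_mem_nhds hx))
  rw [← this, mellinInv]
  simp only [heq, smul_eq_mul]

lemma rieszKernel_isBigO (h : ∀ z : ℂ, 1 / 2 < z.re → subOneMulZeta z ≠ 0)
    {ε : ℝ} (hε : 0 < ε) (hε₁ : ε ≤ 1 / 2) :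
    rieszKernel =O[atTop] fun x : ℝ => x ^ (-(3 / 4 - ε) : ℝ) := by
  obtain ⟨K, hK₀, hK⟩ := exists_norm_rieszMellin_le h hε
  refine IsBigO.of_bound ((1 / (2 * Real.pi)) * ∫ y : ℝ, K * (1 + y ^ 2)⁻¹) ?_
  filter_upwards [eventually_ge_atTop 1] with x hx
  have hx₀ : 0 < x := by linarith
  have hxne : (x : ℂ) ≠ 0 := ofReal_ne_zero.2 hx₀.ne'
  have hnorm : ∀ w : ℂ, ‖(x : ℂ) ^ (-w)‖ = x ^ (-w.re) := fun w => by
    rw [norm_cpow_eq_rpow_re_of_pos hx₀, neg_re]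
  have hbound : ∀ w : ℂ, w.re ∈ Set.Icc (1 / 4) (3 / 4 - ε) →
      ‖(x : ℂ) ^ (-w) * rieszMellin w‖ ≤ x ^ (-w.re) * (K * (1 + w.im ^ 2)⁻¹) := fun w hw => by
    rw [norm_mul, hnorm]
    gcongr
    exact hK w hw
  have hshift := integral_vertical_line_eq (a := 1 / 4) (b := 3 / 4 - ε) (C := K)
    (f := fun w => (x : ℂ) ^ (-w) * rieszMellin w) (by linarith)
    (DifferentiableOn.mul
      (fun w _ => (((hasDerivAt_neg w).const_cpow
        (Or.inl hxne)).differentiableAt).differentiableWithinAt)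
      (differentiableOn_rieszMellin h hε))
    (fun w hw => by
      refine (hbound w hw).trans (mul_le_of_le_one_left (by positivity) ?_)
      exact Real.rpow_le_one_of_one_le_of_nonpos hx (by linarith [hw.1]))
  rw [rieszKernel_eq_mellinInv h hx₀, hshift, norm_smul,
    Real.norm_of_nonneg (by positivity), mul_assoc, Real.norm_of_nonneg (by positivity)]
  gcongr
  rw [← MeasureTheory.integral_mul_const]
  refine MeasureTheory.norm_integral_le_of_norm_le
    ((integrable_inv_one_add_sq.const_mul K).mul_const _) (Eventually.of_forall fun y => ?_)
  have := hbound ((3 / 4 - ε : ℝ) + y * I) (by simpa using by linarith)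
  rw [mul_comm (K * _)]
  simpa using this

lemma mul_rieszKernel_isBigO (h : ∀ z : ℂ, 1 / 2 < z.re → subOneMulZeta z ≠ 0)
    {ε : ℝ} (hε : 0 < ε) :
    (fun x : ℝ => (x : ℂ) * rieszKernel x) =O[atTop] fun x : ℝ => x ^ (1 / 4 + ε : ℝ) := by
  have h1 := rieszKernel_isBigO h (ε := min ε (1 / 2)) (by positivity) (min_le_right _ _)
  have h2 : (fun x : ℝ => (x : ℂ)) =O[atTop] fun x : ℝ => x :=
    IsBigO.of_bound 1 (Eventually.of_forall fun x => by simp)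
  refine (h2.mul h1).trans (IsBigO.of_bound 1 ?_)
  filter_upwards [eventually_ge_atTop 1] with x hx
  have hx₀ : 0 < x := by linarith
  rw [one_mul, Real.norm_of_nonneg (by positivity), Real.norm_of_nonneg (by positivity)]
  calc x * x ^ (-(3 / 4 - min ε (1 / 2)) : ℝ) = x ^ (1 + -(3 / 4 - min ε (1 / 2)) : ℝ) := by
        rw [Real.rpow_add hx₀, Real.rpow_one]
    _ ≤ _ := Real.rpow_le_rpow_of_exponent_le hx (by linarith [min_le_left ε (1 / 2)])

/-- The Riemann hypothesis holds iff for every `ε > 0` we have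
`Riesz(x) = O(x^{1/4+ε})` as `x → ∞` along the positive reals, where
`Riesz(x) = Σ_{k≥1} (-1)^{k+1} x^k / ((k-1)! ζ(2k))` (reindexed by `k ↦ k + 1`). -/
theorem riemannHypothesis_iff_riesz_isBigO :
    RiemannHypothesis ↔
      ∀ ε : ℝ, 0 < ε →
        (fun x : ℝ => ∑' k : ℕ, (-1 : ℂ) ^ k * (x : ℂ) ^ (k + 1) /
            ((Nat.factorial k : ℂ) * riemannZeta (2 * ((k : ℂ) + 1))))
          =O[atTop] fun x : ℝ => x ^ (1 / 4 + ε : ℝ) := by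
  have hcongr : (fun x : ℝ => ∑' k : ℕ, (-1 : ℂ) ^ k * (x : ℂ) ^ (k + 1) /
      ((Nat.factorial k : ℂ) * riemannZeta (2 * ((k : ℂ) + 1)))) =ᶠ[atTop]
      fun x : ℝ => (x : ℂ) * rieszKernel x := by
    filter_upwards [eventually_ge_atTop 0] with x hx using riesz_eq_mul_rieszKernel hx
  rw [riemannHypothesis_iff_subOneMulZeta_ne_zero]
  constructor
  · intro h ε hε
    exact (mul_rieszKernel_isBigO h hε).congr' hcongr.symm EventuallyEq.rfl
  · intro h z hz
    exact subOneMulZeta_ne_zero_of_isBigO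
      (fun ε hε => rieszKernel_isBigO_of_mul ((h ε hε).congr' hcongr EventuallyEq.rfl)) hz
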